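/- arXiv:1905.09750 — 2 statements merged into one kernel-verified Lean document; each statement's English description precedes it below -/
import Mathlib

section
/- Consider a GEBP instance with f_i = c_i·σ_i and σ_i ≥ 1 for all machines i, let h be a machine with σ_h = 1, and let ε ∈ (0,1) be such that k = 1/ε is a positive integer. Let t_min ∈ {0,…,k−1} minimize Σ_{i∈M(t)} f_i over t. Then for every nice assignment A there exists a nice assignment A' that assigns no job to any machine in M(t_min) \ {h} and satisfies cost(A') ≤ (1+ε)·cost(A). -/
/-- The machine cost function: `cost(L) = f` if `L ≤ c`, and `f + σ·(L - c)` otherwise. -/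
noncomputable def mcost (f c σ L : ℝ) : ℝ := if L ≤ c then f else f + σ * (L - c)

/-- The load of machine `i` under assignment `A` with job sizes `p`. -/
noncomputable def mload {m n : ℕ} (p : Fin n → ℝ) (A : Fin n → Fin m) (i : Fin m) : ℝ :=
  ∑ j ∈ Finset.univ.filter (fun j => A j = i), p j

/-- The total cost of assignment `A` in the GEBP instance `(f, c, σ, p)`. -/
noncomputable def gcost {m n : ℕ} (f c σ : Fin m → ℝ) (p : Fin n → ℝ)
    (A : Fin n → Fin m) : ℝ :=
  ∑ i, mcost (f i) (c i) (σ i) (mload p A i)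

theorem le_mcost {f c σ : ℝ} (hσ : 0 ≤ σ) (L : ℝ) : f ≤ mcost f c σ L := by
  unfold mcost
  split_ifs with hL
  · exact le_rfl
  · nlinarith

theorem mcost_zero_add_le {f c σ L : ℝ} (hc : 0 ≤ c) (hσ : 1 ≤ σ) :
    mcost f c σ 0 + L ≤ mcost f c σ L + c := by
  unfold mcost
  rw [if_pos hc]
  split_ifs with hL
  · linarith
  · nlinarith

theorem mcost_one_add_le {f c L x : ℝ} (hx : 0 ≤ x) :
    mcost f c 1 (L + x) ≤ mcost f c 1 L + x := by
  unfold mcost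
  split_ifs <;> linarith

theorem mload_nonneg {m n : ℕ} {p : Fin n → ℝ} (hp : ∀ j, 0 ≤ p j) (A : Fin n → Fin m)
    (i : Fin m) : 0 ≤ mload p A i :=
  Finset.sum_nonneg fun j _ => hp j

/-- The assignment obtained from `A` by moving every job on a machine of `S` to `h`. -/
def reassign {m n : ℕ} (A : Fin n → Fin m) (S : Finset (Fin m)) (h : Fin m) (j : Fin n) : Fin m :=
  if A j ∈ S then h else A j

section Reassign

variable {m n : ℕ} (p : Fin n → ℝ) (A : Fin n → Fin m) {S : Finset (Fin m)} {h : Fin m}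

theorem mload_reassign_of_mem {i : Fin m} (hi : i ∈ S) (hih : i ≠ h) :
    mload p (reassign A S h) i = 0 := by
  unfold mload
  rw [Finset.filter_false_of_mem, Finset.sum_empty]
  intro j _ hj
  unfold reassign at hj
  split_ifs at hj with hjS
  · exact hih hj.symm
  · exact hjS (hj ▸ hi)

theorem mload_reassign_of_notMem {i : Fin m} (hi : i ∉ S) (hih : i ≠ h) :
    mload p (reassign A S h) i = mload p A i := by
  unfold mload
  refine Finset.sum_congr (Finset.filter_congr fun j _ => ?_) fun _ _ => rfl
  unfold reassign
  split_ifs with hjS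
  · exact ⟨fun e => absurd e.symm hih, fun e => absurd (e ▸ hjS) hi⟩
  · rfl

theorem mload_reassign_target (hS : h ∉ S) :
    mload p (reassign A S h) h = mload p A h + ∑ i ∈ S, mload p A i := by
  have hsum : ∑ i ∈ S, mload p A i = ∑ j, if A j ∈ S then p j else 0 := by
    simp only [mload, Finset.sum_filter]
    rw [Finset.sum_comm]
    simp
  rw [hsum]
  simp only [mload, Finset.sum_filter]
  rw [← Finset.sum_add_distrib]
  refine Finset.sum_congr rfl fun j _ => ?_
  unfold reassign
  by_cases hj : A j ∈ S
  · have hne : A j ≠ h := fun e => hS (e ▸ hj)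
    simp [hj, hne]
  · simp [hj]

theorem gcost_reassign_le {f c σ : Fin m → ℝ} (hc : ∀ i, 0 ≤ c i) (hσ : ∀ i, 1 ≤ σ i)
    (hp : ∀ j, 0 ≤ p j) (hσh : σ h = 1) (hS : h ∉ S) :
    gcost f c σ p (reassign A S h) ≤ gcost f c σ p A + ∑ i ∈ S, c i := by
  have key : ∀ i, mcost (f i) (c i) (σ i) (mload p (reassign A S h) i) ≤
      mcost (f i) (c i) (σ i) (mload p A i) + (if i ∈ S then c i - mload p A i else 0) +
        (if i = h then ∑ i ∈ S, mload p A i else 0) := by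
    intro i
    by_cases hih : i = h
    · subst hih
      rw [mload_reassign_target p A hS, hσh, if_neg hS, if_pos rfl, add_zero]
      exact mcost_one_add_le (Finset.sum_nonneg fun i _ => mload_nonneg hp A i)
    · by_cases hi : i ∈ S
      · rw [mload_reassign_of_mem p A hi hih, if_pos hi, if_neg hih]
        linarith [mcost_zero_add_le (f := f i) (hc i) (hσ i) (L := mload p A i)]
      · simp [mload_reassign_of_notMem p A hi hih, hi, hih]
  refine (Finset.sum_le_sum fun i _ => key i).trans_eq ?_
  simp [gcost, Finset.sum_add_distrib, Finset.sum_sub_distrib]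
  ring

end Reassign

/-- A residue class modulo `k` of minimum total weight carries at most a `1 / k` fraction of the
total weight. -/
theorem mul_sum_minimal_residue_le {ι : Type*} [Fintype ι] {k : ℕ} (hk : 0 < k) (g : ι → ℤ)
    (f : ι → ℝ) (s : ℕ)
    (hmin : ∀ t : ℕ, t < k →
      ∑ i ∈ Finset.univ.filter (fun i => g i % (k : ℤ) = (s : ℤ)), f i ≤
      ∑ i ∈ Finset.univ.filter (fun i => g i % (k : ℤ) = (t : ℤ)), f i) :
    k * ∑ i ∈ Finset.univ.filter (fun i => g i % (k : ℤ) = (s : ℤ)), f i ≤ ∑ i, f i := by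
  have hk' : (0 : ℤ) < k := by exact_mod_cast hk
  have hmaps : ∀ i ∈ (Finset.univ : Finset ι), (g i % (k : ℤ)).toNat ∈ Finset.range k := by
    intro i _
    have h1 := Int.emod_nonneg (g i) hk'.ne'
    have h2 := Int.emod_lt_of_pos (g i) hk'
    rw [Finset.mem_range]
    omega
  rw [← Finset.sum_fiberwise_of_maps_to hmaps f, ← nsmul_eq_mul]
  refine (congrArg (· • _) (Finset.card_range k)).ge.trans
    (Finset.card_nsmul_le_sum (Finset.range k) _ _ fun t ht => ?_)
  refine (hmin t (Finset.mem_range.mp ht)).trans_eq (Finset.sum_congr ?_ fun _ _ => rfl)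
  ext i
  have h1 := Int.emod_nonneg (g i) hk'.ne'
  simp only [Finset.mem_filter, Finset.mem_univ, true_and]
  omega

theorem stmt8 (m n k : ℕ) (hk : 0 < k) (ε : ℝ) (hε0 : 0 < ε) (hε1 : ε < 1)
    (hkε : (k : ℝ) = 1 / ε)
    (f c σ : Fin m → ℝ) (p : Fin n → ℝ)
    (hf : ∀ i, 0 < f i) (hc : ∀ i, 0 < c i) (hσ : ∀ i, 1 ≤ σ i)
    (hfcσ : ∀ i, f i = c i * σ i) (hp : ∀ j, 0 ≤ p j)
    (h : Fin m) (hσh : σ h = 1)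
    (tmin : ℕ) (htmin : tmin < k)
    (hmin : ∀ t : ℕ, t < k →
      ∑ i ∈ Finset.univ.filter
          (fun i => ⌈Real.logb ((1/ε)^2) (c i)⌉ % (k : ℤ) = (tmin : ℤ)), f i ≤
      ∑ i ∈ Finset.univ.filter
          (fun i => ⌈Real.logb ((1/ε)^2) (c i)⌉ % (k : ℤ) = (t : ℤ)), f i)
    (A : Fin n → Fin m) (hA : ∀ i, i ≠ h → mload p A i ≤ c i / ε) :
    ∃ A' : Fin n → Fin m,
      (∀ i, i ≠ h → mload p A' i ≤ c i / ε) ∧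
      (∀ j, ⌈Real.logb ((1/ε)^2) (c (A' j))⌉ % (k : ℤ) = (tmin : ℤ) → A' j = h) ∧
      gcost f c σ p A' ≤ (1 + ε) * gcost f c σ p A := by
  set M := Finset.univ.filter
    (fun i => ⌈Real.logb ((1/ε)^2) (c i)⌉ % (k : ℤ) = (tmin : ℤ))
  have hS : h ∉ M.erase h := Finset.notMem_erase h M
  refine ⟨reassign A (M.erase h) h, fun i hi => ?_, fun j hj => ?_, ?_⟩
  · by_cases hiS : i ∈ M.erase h
    · rw [mload_reassign_of_mem p A hiS hi]
      exact (div_pos (hc i) hε0).le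
    · rw [mload_reassign_of_notMem p A hiS hi]
      exact hA i hi
  · by_contra hne
    have hmem : reassign A (M.erase h) h j ∈ M.erase h :=
      Finset.mem_erase.mpr ⟨hne, Finset.mem_filter.mpr ⟨Finset.mem_univ _, hj⟩⟩
    by_cases hjS : A j ∈ M.erase h
    · exact hne (if_pos hjS)
    · rw [reassign, if_neg hjS] at hmem
      exact hjS hmem
  · have hcost := gcost_reassign_le (f := f) p A (fun i => (hc i).le) hσ hp hσh hS
    have hcf : ∑ i ∈ M.erase h, c i ≤ ∑ i ∈ M, f i :=
      (Finset.sum_le_sum fun i _ => by rw [hfcσ]; nlinarith [hc i, hσ i]).trans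
        (Finset.sum_le_sum_of_subset_of_nonneg (Finset.erase_subset h M)
          fun i _ _ => (hf i).le)
    have havg : k * ∑ i ∈ M, f i ≤ ∑ i, f i := mul_sum_minimal_residue_le hk _ f tmin hmin
    have hfA : ∑ i, f i ≤ gcost f c σ p A :=
      Finset.sum_le_sum fun i _ => le_mcost (zero_le_one.trans (hσ i)) _
    have hMε : ∑ i ∈ M, f i ≤ ε * gcost f c σ p A := by
      rw [hkε, one_div, inv_mul_le_iff₀ hε0] at havg
      exact havg.trans (mul_le_mul_of_nonneg_left hfA hε0.le)
    linarith
end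

section
/- Consider an instance of BPc with m machine types satisfying f_i = c_i·σ_i for every type i, and let ε ∈ (0,1]. Then for every solution Sol of BPc there exists a solution Sol' of BPc such that every machine μ of Sol' is either assigned exactly one job or has load at most c_{t(μ)}/ε (where t(μ) is the type of μ), and the cost of Sol' is at most (1+2ε) times the cost of Sol. -/
/-- The load of machine `μ` under the job assignment `A` with job sizes `p`. -/
noncomputable def bload {M n : ℕ} (p : Fin n → ℝ) (A : Fin n → Fin M) (μ : Fin M) : ℝ :=
  ∑ j ∈ Finset.univ.filter (fun j => A j = μ), p j

/-- The cost of a BPc solution consisting of `M` machines, machine `μ` having type `t μ`,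
with jobs assigned via `A`. -/
noncomputable def bcost {m M n : ℕ} (f c σ : Fin m → ℝ) (p : Fin n → ℝ)
    (t : Fin M → Fin m) (A : Fin n → Fin M) : ℝ :=
  ∑ μ, mcost (f (t μ)) (c (t μ)) (σ (t μ)) (bload p A μ)

/-- When `f = c·σ`, the machine cost is `σ · max c L`. -/
theorem mcost_eq_mul_max {f c σ : ℝ} (h : f = c * σ) (L : ℝ) :
    mcost f c σ L = σ * max c L := by
  unfold mcost
  split_ifs with hL
  · rw [max_eq_left hL, h, mul_comm]
  · rw [max_eq_right (not_le.mp hL).le, h]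
    ring

/-- Greedy packing: the items of `s` can be packed into an open bin `0` of load at most `K` and
closed bins `1, …, k` of load at least `K / 2`, each of which has load at most `K` or contains
a single item. -/
theorem exists_greedy_packing {J : Type*} [DecidableEq J] (p : J → ℝ) {K : ℝ} (hK : 0 ≤ K)
    (s : Finset J) :
    ∃ (k : ℕ) (g : J → ℕ), (∀ j ∈ s, g j ≤ k) ∧
      (∑ j ∈ s.filter (fun j => g j = 0), p j ≤ K) ∧
      ∀ i, 1 ≤ i → i ≤ k →
        ((s.filter (fun j => g j = i)).card = 1 ∨
          ∑ j ∈ s.filter (fun j => g j = i), p j ≤ K) ∧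
        K ≤ 2 * ∑ j ∈ s.filter (fun j => g j = i), p j := by
  induction s using Finset.induction_on with
  | empty => exact ⟨0, fun _ => 0, by simp, by simpa using hK, fun i h₁ h₂ => by omega⟩
  | insert x s hx ih =>
    obtain ⟨k, g, hg, hopen, hclosed⟩ := ih
    have hne : ∀ j ∈ s, j ≠ x := fun j hj h => hx (h ▸ hj)
    by_cases hfit : p x + ∑ j ∈ s.filter (fun j => g j = 0), p j ≤ K
    · have bin_open : (insert x s).filter (fun j => (if j = x then 0 else g j) = 0) =
          insert x (s.filter (fun j => g j = 0)) := by
        ext j; simp only [Finset.mem_filter, Finset.mem_insert]; grind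
      have bin_closed : ∀ i, 1 ≤ i →
          (insert x s).filter (fun j => (if j = x then 0 else g j) = i) =
          s.filter (fun j => g j = i) := by
        intro i hi
        ext j; simp only [Finset.mem_filter, Finset.mem_insert]; grind
      refine ⟨k, fun j => if j = x then 0 else g j, by grind, ?_, fun i h₁ h₂ => ?_⟩
      · rw [bin_open, Finset.sum_insert (by simp [hx])]
        exact hfit
      · rw [bin_closed i h₁]
        exact hclosed i h₁ h₂
    · rcases le_total (∑ j ∈ s.filter (fun j => g j = 0), p j) (p x) with hle | hle
      · have bin_old : ∀ i ≤ k,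
            (insert x s).filter (fun j => (if j = x then k + 1 else g j) = i) =
            s.filter (fun j => g j = i) := by
          intro i hi
          ext j; simp only [Finset.mem_filter, Finset.mem_insert]; grind
        have bin_new : (insert x s).filter (fun j => (if j = x then k + 1 else g j) = k + 1) =
            {x} := by
          ext j; simp only [Finset.mem_filter, Finset.mem_insert, Finset.mem_singleton]; grind
        refine ⟨k + 1, fun j => if j = x then k + 1 else g j, by grind, ?_, fun i h₁ h₂ => ?_⟩
        · rw [bin_old 0 k.zero_le]
          exact hopen
        · rcases Nat.le_succ_iff.mp h₂ with h | rfl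
          · rw [bin_old i h]
            exact hclosed i h₁ h
          · rw [bin_new]
            refine ⟨Or.inl (Finset.card_singleton x), ?_⟩
            rw [Finset.sum_singleton]
            linarith
      · let g' : J → ℕ := fun j => if j = x then 0 else if g j = 0 then k + 1 else g j
        have bin_open : (insert x s).filter (fun j => g' j = 0) = {x} := by
          ext j; simp only [g', Finset.mem_filter, Finset.mem_insert, Finset.mem_singleton]; grind
        have bin_old : ∀ i, 1 ≤ i → i ≤ k →
            (insert x s).filter (fun j => g' j = i) = s.filter (fun j => g j = i) := by
          intro i h₁ h₂
          ext j; simp only [g', Finset.mem_filter, Finset.mem_insert]; grind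
        have bin_new : (insert x s).filter (fun j => g' j = k + 1) =
            s.filter (fun j => g j = 0) := by
          ext j; simp only [g', Finset.mem_filter, Finset.mem_insert]; grind
        refine ⟨k + 1, g', by grind, ?_, fun i h₁ h₂ => ?_⟩
        · rw [bin_open, Finset.sum_singleton]
          exact hle.trans hopen
        · rcases Nat.le_succ_iff.mp h₂ with h | rfl
          · rw [bin_old i h₁ h]
            exact hclosed i h₁ h
          · rw [bin_new]
            exact ⟨Or.inr hopen, by linarith⟩

/-- The jobs of one machine can be distributed over machines of the same type, each of which has
a single job or load at most `c / ε`, at a cost increase of a factor at most `1 + 2ε`. -/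
theorem exists_machine_split {J : Type*} [DecidableEq J] (p : J → ℝ) (hp : ∀ j, 0 ≤ p j)
    {c ε : ℝ} (hc : 0 < c) (hε0 : 0 < ε) (hε1 : ε ≤ 1) (s : Finset J) :
    ∃ (k : ℕ) (g : J → ℕ), (∀ j ∈ s, g j < k) ∧
      (∀ i < k, (s.filter (fun j => g j = i)).card = 1 ∨
        ∑ j ∈ s.filter (fun j => g j = i), p j ≤ c / ε) ∧
      ∑ i ∈ Finset.range k, max c (∑ j ∈ s.filter (fun j => g j = i), p j) ≤
        (1 + 2 * ε) * max c (∑ j ∈ s, p j) := by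
  by_cases hL : ∑ j ∈ s, p j ≤ c / ε
  · refine ⟨1, fun _ => 0, by simp, fun i hi => Or.inr ?_, ?_⟩
    · exact (Finset.sum_le_sum_of_subset_of_nonneg (Finset.filter_subset _ _)
        fun j _ _ => hp j).trans hL
    · have : 0 < max c (∑ j ∈ s, p j) := lt_max_of_lt_left hc
      simp only [Finset.range_one, Finset.sum_singleton, Finset.filter_true]
      nlinarith
  · obtain ⟨k, g, hg, hopen, hclosed⟩ := exists_greedy_packing p (div_pos hc hε0).le s
    refine ⟨k + 1, g, fun j hj => Nat.lt_succ_of_le (hg j hj), fun i hi => ?_, ?_⟩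
    · rcases Nat.eq_zero_or_pos i with rfl | h
      · exact Or.inr hopen
      · exact (hclosed i h (Nat.le_of_lt_succ hi)).1
    · have hcL : c < ε * ∑ j ∈ s, p j := by
        rw [not_le, div_lt_iff₀ hε0] at hL
        linarith
      have hload : ∀ i, 0 ≤ ∑ j ∈ s.filter (fun j => g j = i), p j :=
        fun i => Finset.sum_nonneg fun j _ => hp j
      have hsum : ∑ i ∈ Finset.range (k + 1), ∑ j ∈ s.filter (fun j => g j = i), p j =
          ∑ j ∈ s, p j :=
        Finset.sum_fiberwise_of_maps_to
          (fun j hj => Finset.mem_range.mpr (Nat.lt_succ_of_le (hg j hj))) p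
      have hbins : ∑ i ∈ Finset.range k, max c (∑ j ∈ s.filter (fun j => g j = i + 1), p j) ≤
          ∑ i ∈ Finset.range k, (1 + ε) * ∑ j ∈ s.filter (fun j => g j = i + 1), p j := by
        refine Finset.sum_le_sum fun i hi => ?_
        have hhalf := (hclosed (i + 1) (by omega) (Finset.mem_range.mp hi)).2
        rw [div_le_iff₀ hε0] at hhalf
        have := hload (i + 1)
        refine max_le ?_ ?_ <;> nlinarith
      have hzero : max c (∑ j ∈ s.filter (fun j => g j = 0), p j) ≤
          c + ∑ j ∈ s.filter (fun j => g j = 0), p j :=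
        max_le (by linarith [hload 0]) (by linarith)
      have hmax : ∑ j ∈ s, p j ≤ max c (∑ j ∈ s, p j) := le_max_right _ _
      rw [← Finset.mul_sum] at hbins
      rw [Finset.sum_range_succ'] at hsum ⊢
      nlinarith [hload 0]

theorem stmt16 (m n : ℕ) (f c σ : Fin m → ℝ) (p : Fin n → ℝ)
    (hf : ∀ i, 0 < f i) (hc : ∀ i, 0 < c i) (hσ : ∀ i, 0 < σ i)
    (hfcσ : ∀ i, f i = c i * σ i) (hp : ∀ j, 0 ≤ p j)
    (ε : ℝ) (hε0 : 0 < ε) (hε1 : ε ≤ 1)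
    (M : ℕ) (t : Fin M → Fin m) (A : Fin n → Fin M) :
    ∃ (M' : ℕ) (t' : Fin M' → Fin m) (A' : Fin n → Fin M'),
      (∀ μ : Fin M',
        (Finset.univ.filter (fun j => A' j = μ)).card = 1 ∨
        bload p A' μ ≤ c (t' μ) / ε) ∧
      bcost f c σ p t' A' ≤ (1 + 2 * ε) * bcost f c σ p t A := by
  choose k g hg hgood hcost using fun μ : Fin M =>
    exists_machine_split p hp (hc (t μ)) hε0 hε1 (Finset.univ.filter (fun j => A j = μ))
  let e := finSigmaFinEquiv (n := k)
  let A' : Fin n → Fin (∑ μ, k μ) := fun j => e ⟨A j, ⟨g (A j) j, hg (A j) j (by simp)⟩⟩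
  have hbin : ∀ x : (μ : Fin M) × Fin (k μ), Finset.univ.filter (fun j => A' j = e x) =
      (Finset.univ.filter (fun j => A j = x.1)).filter (fun j => g x.1 j = x.2) := by
    rintro ⟨μ, i, hi⟩
    ext j
    simp only [A', Finset.mem_filter, Finset.mem_univ, true_and, e.apply_eq_iff_eq]
    constructor
    · intro h
      obtain ⟨rfl, h⟩ := Sigma.mk.inj_iff.mp h
      exact ⟨rfl, congrArg Fin.val (eq_of_heq h)⟩
    · rintro ⟨rfl, rfl⟩
      rfl
  refine ⟨∑ μ, k μ, fun ν => t (e.symm ν).1, A', fun ν => ?_, ?_⟩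
  · obtain ⟨x, rfl⟩ := e.surjective ν
    simp only [bload, hbin, e.symm_apply_apply]
    exact hgood x.1 x.2 x.2.isLt
  · simp only [bcost, mcost_eq_mul_max (hfcσ _)]
    rw [← e.sum_comp, Fintype.sum_sigma, Finset.mul_sum]
    refine Finset.sum_le_sum fun μ _ => ?_
    simp only [bload, hbin, e.symm_apply_apply]
    rw [← Finset.mul_sum, Fin.sum_univ_eq_sum_range (fun i => max (c (t μ))
      (∑ j ∈ (Finset.univ.filter (fun j => A j = μ)).filter (fun j => g μ j = i), p j)),
      mul_left_comm]
    exact mul_le_mul_of_nonneg_left (hcost μ) (hσ _).le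
end
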